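/- Let d ∈ ℕ, d ≥ 2, m > 0, γ ∈ (0, 1/2), let f ∈ 𝒮(ℝ^d, ℂ), and let Λ be a real d × d matrix with ΛᵀẼΛ = Ẽ, det Λ = 1 and Λ₀₀ > 0 (a restricted Lorentz matrix). Then the operator J h := 𝓕⁻¹(j·𝓕h) intertwines with the Lorentz action: for every x ∈ ℝ^d, (J(f ∘ Λ))(x) = (J f)(Λx), where f ∘ Λ denotes the Schwartz function y ↦ f(Λy). -/

import Mathlib

open MeasureTheory FourierTransform

/-- The symbol `j(τ,ξ) = (τ² − (|ξ|² + m²))^(−γ)` on the forward mass region,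
`0` elsewhere, on `ℝ^d ≅ ℝ × ℝ^{d−1}` (coordinate `0` is `τ`). -/
noncomputable def jmass (d : ℕ) [NeZero d] (m γ : ℝ)
    (x : EuclideanSpace ℝ (Fin d)) : ℝ :=
  if Real.sqrt ((∑ i ∈ Finset.univ.erase 0, x i ^ 2) + m ^ 2) < x 0 then
    (x 0 ^ 2 - ((∑ i ∈ Finset.univ.erase 0, x i ^ 2) + m ^ 2)) ^ (-γ)
  else 0

/-- The Minkowski metric matrix `Ẽ = diag(1, −1, …, −1)`. -/
def minkMatrix (d : ℕ) [NeZero d] : Matrix (Fin d) (Fin d) ℝ :=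
  Matrix.diagonal fun i => if i = 0 then 1 else -1

/-- Action of a `d × d` real matrix on `ℝ^d`. -/
noncomputable def matAct (d : ℕ) (Λ : Matrix (Fin d) (Fin d) ℝ)
    (x : EuclideanSpace ℝ (Fin d)) : EuclideanSpace ℝ (Fin d) :=
  (EuclideanSpace.equiv (Fin d) ℝ).symm (Λ.mulVec (EuclideanSpace.equiv (Fin d) ℝ x))

/-- The operator `J h = 𝓕⁻¹(j · 𝓕 h)`. -/
noncomputable def Jop (d : ℕ) [NeZero d] (m γ : ℝ)
    (h : EuclideanSpace ℝ (Fin d) → ℂ) : EuclideanSpace ℝ (Fin d) → ℂ :=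
  𝓕⁻ (fun ξ => (jmass d m γ ξ : ℂ) * 𝓕 h ξ)

lemma matAct_apply (d : ℕ) (Λ : Matrix (Fin d) (Fin d) ℝ) (x : EuclideanSpace ℝ (Fin d))
    (i : Fin d) : matAct d Λ x i = ∑ j, Λ i j * x j := rfl

lemma matAct_mul (d : ℕ) (A B : Matrix (Fin d) (Fin d) ℝ) (x : EuclideanSpace ℝ (Fin d)) :
    matAct d (A * B) x = matAct d A (matAct d B x) :=
  congrArg (WithLp.toLp 2) (Matrix.mulVec_mulVec x.ofLp A B).symm

lemma matAct_one (d : ℕ) (x : EuclideanSpace ℝ (Fin d)) : matAct d 1 x = x := by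
  simp [matAct]

lemma continuous_matAct (d : ℕ) (Λ : Matrix (Fin d) (Fin d) ℝ) : Continuous (matAct d Λ) := by
  unfold matAct
  fun_prop

lemma inner_matAct_left (d : ℕ) (Λ : Matrix (Fin d) (Fin d) ℝ) (x y : EuclideanSpace ℝ (Fin d)) :
    inner ℝ (matAct d Λ x) y = inner ℝ x (matAct d Λ.transpose y) := by
  simp only [PiLp.inner_apply, matAct_apply, RCLike.inner_apply, conj_trivial,
    Matrix.transpose_apply, Finset.mul_sum, Finset.sum_mul]
  rw [Finset.sum_comm]
  exact Finset.sum_congr rfl fun i _ => Finset.sum_congr rfl fun j _ => by ring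

lemma measurePreserving_matAct (d : ℕ) (Λ : Matrix (Fin d) (Fin d) ℝ) (hdet : Λ.det = 1) :
    MeasurePreserving (matAct d Λ) := by
  have h : MeasurePreserving (Matrix.toLin' Λ) := by
    refine ⟨(LinearMap.continuous_of_finiteDimensional _).measurable, ?_⟩
    rw [Real.map_matrix_volume_pi_eq_smul_volume_pi (by simp [hdet])]
    simp [hdet]
  exact (PiLp.volume_preserving_toLp (Fin d)).comp
    (h.comp (PiLp.volume_preserving_ofLp (Fin d)))

lemma integral_comp_matAct {E : Type*} [NormedAddCommGroup E] [NormedSpace ℝ E] (d : ℕ)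
    (Λ : Matrix (Fin d) (Fin d) ℝ) (hdet : Λ.det = 1) (g : EuclideanSpace ℝ (Fin d) → E) :
    ∫ x, g (matAct d Λ x) = ∫ x, g x := by
  refine (measurePreserving_matAct d Λ hdet).integral_comp
    ((continuous_matAct d Λ).measurableEmbedding fun x y hxy => ?_) g
  have h := congrArg (matAct d Λ⁻¹) hxy
  rwa [← matAct_mul, ← matAct_mul, Matrix.nonsing_inv_mul _ (by simp [hdet]), matAct_one,
    matAct_one] at h

/-- Precomposition with a unimodular matrix acts on the Fourier side by the inverse transpose. -/
lemma fourier_comp_matAct (d : ℕ) (Λ : Matrix (Fin d) (Fin d) ℝ) (hdet : Λ.det = 1)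
    (f : EuclideanSpace ℝ (Fin d) → ℂ) (ξ : EuclideanSpace ℝ (Fin d)) :
    𝓕 (fun y => f (matAct d Λ y)) (matAct d Λ.transpose ξ) = 𝓕 f ξ := by
  rw [Real.fourier_eq, Real.fourier_eq,
    ← integral_comp_matAct d Λ hdet fun v => 𝐞 (-inner ℝ v ξ) • f v]
  simp only [inner_matAct_left]

/-- The Minkowski quadratic form `τ² − |ξ|²`. -/
noncomputable def minkForm (d : ℕ) [NeZero d] (x : EuclideanSpace ℝ (Fin d)) : ℝ :=
  x 0 ^ 2 - ∑ i ∈ Finset.univ.erase 0, x i ^ 2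

lemma minkForm_eq_dotProduct (d : ℕ) [NeZero d] (x : EuclideanSpace ℝ (Fin d)) :
    minkForm d x = dotProduct x.ofLp ((minkMatrix d).mulVec x.ofLp) := by
  rw [minkForm, dotProduct, ← Finset.add_sum_erase _ _ (Finset.mem_univ (0 : Fin d)),
    sub_eq_add_neg, ← Finset.sum_neg_distrib]
  congr 1
  · simp [minkMatrix, Matrix.mulVec_diagonal, sq]
  · refine Finset.sum_congr rfl fun i hi => ?_
    simp [minkMatrix, Matrix.mulVec_diagonal, sq, Finset.ne_of_mem_erase hi]

lemma minkForm_matAct (d : ℕ) [NeZero d] (Λ : Matrix (Fin d) (Fin d) ℝ)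
    (hΛ : Λ.transpose * minkMatrix d * Λ = minkMatrix d) (x : EuclideanSpace ℝ (Fin d)) :
    minkForm d (matAct d Λ x) = minkForm d x := by
  have h : (matAct d Λ x).ofLp = Λ.mulVec x.ofLp := rfl
  rw [minkForm_eq_dotProduct, minkForm_eq_dotProduct, h]
  conv_rhs => rw [← hΛ, ← Matrix.mulVec_mulVec, ← Matrix.mulVec_mulVec, Matrix.dotProduct_mulVec,
    Matrix.vecMul_transpose]

lemma minkMatrix_mul_self (d : ℕ) [NeZero d] : minkMatrix d * minkMatrix d = 1 := by
  rw [minkMatrix, Matrix.diagonal_mul_diagonal, ← Matrix.diagonal_one]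
  congr 1
  ext i
  split_ifs <;> simp

lemma lorentz_transpose (d : ℕ) [NeZero d] (Λ : Matrix (Fin d) (Fin d) ℝ)
    (hΛ : Λ.transpose * minkMatrix d * Λ = minkMatrix d) :
    Λ * minkMatrix d * Λ.transpose = minkMatrix d := by
  have h : minkMatrix d * Λ.transpose * minkMatrix d * Λ = 1 := by
    rw [Matrix.mul_assoc, Matrix.mul_assoc, ← Matrix.mul_assoc Λ.transpose, hΛ,
      minkMatrix_mul_self]
  have h2 := congrArg (· * minkMatrix d) (mul_eq_one_comm.mp h)
  simpa [Matrix.mul_assoc, minkMatrix_mul_self] using h2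

/-- Two future-directed timelike vectors have positive Euclidean inner product. -/
lemma inner_pos_of_minkForm_pos (d : ℕ) [NeZero d] (a x : EuclideanSpace ℝ (Fin d))
    (ha : 0 < minkForm d a) (ha0 : 0 < a 0) (hx : 0 < minkForm d x) (hx0 : 0 < x 0) :
    0 < ∑ i, a i * x i := by
  rw [← Finset.add_sum_erase _ _ (Finset.mem_univ (0 : Fin d))]
  rw [minkForm, sub_pos] at ha hx
  have hcs := Finset.sum_mul_sq_le_sq_mul_sq (Finset.univ.erase (0 : Fin d)) a x
  have hlt : (∑ i ∈ Finset.univ.erase (0 : Fin d), a i * x i) ^ 2 < (a 0 * x 0) ^ 2 := by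
    rw [mul_pow]
    exact hcs.trans_lt (mul_lt_mul'' ha hx (by positivity) (by positivity))
  linarith [(abs_lt.mp (abs_lt_of_sq_lt_sq hlt (by positivity))).1]

lemma minkForm_neg (d : ℕ) [NeZero d] (x : EuclideanSpace ℝ (Fin d)) :
    minkForm d (-x) = minkForm d x := by
  simp [minkForm]

lemma matAct_transpose_zero_pos (d : ℕ) [NeZero d] (Λ : Matrix (Fin d) (Fin d) ℝ)
    (hΛ : Λ.transpose * minkMatrix d * Λ = minkMatrix d) (hor : 0 < Λ 0 0)
    (x : EuclideanSpace ℝ (Fin d)) (hx : 0 < minkForm d x) (hx0 : 0 < x 0) :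
    0 < matAct d Λ.transpose x 0 := by
  have hcol : matAct d Λ (EuclideanSpace.single 0 1) = WithLp.toLp 2 fun i => Λ i 0 := by
    ext i
    simp [matAct_apply]
  have hone : minkForm d (EuclideanSpace.single 0 1) = 1 := by
    rw [minkForm, Finset.sum_eq_zero fun i hi => by simp [Finset.ne_of_mem_erase hi]]
    simp
  have ha := minkForm_matAct d Λ hΛ (EuclideanSpace.single 0 1)
  rw [hcol, hone] at ha
  exact inner_pos_of_minkForm_pos d (WithLp.toLp 2 fun i => Λ i 0) x (by simp [ha]) hor hx hx0

lemma matAct_transpose_zero_pos_iff (d : ℕ) [NeZero d] (Λ : Matrix (Fin d) (Fin d) ℝ)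
    (hΛ : Λ.transpose * minkMatrix d * Λ = minkMatrix d) (hor : 0 < Λ 0 0)
    (x : EuclideanSpace ℝ (Fin d)) (hx : 0 < minkForm d x) :
    0 < matAct d Λ.transpose x 0 ↔ 0 < x 0 := by
  refine ⟨fun h => ?_, matAct_transpose_zero_pos d Λ hΛ hor x hx⟩
  by_contra! hx0
  rcases hx0.lt_or_eq with hneg | hzero
  · have h2 := matAct_transpose_zero_pos d Λ hΛ hor (-x) (by rwa [minkForm_neg]) (by simpa)
    simp only [matAct_apply, PiLp.neg_apply, mul_neg, Finset.sum_neg_distrib] at h h2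
    linarith
  · have h3 : 0 ≤ ∑ i ∈ Finset.univ.erase (0 : Fin d), x i ^ 2 := by positivity
    rw [minkForm, hzero] at hx
    linarith

lemma jmass_eq (d : ℕ) [NeZero d] (m γ : ℝ) (x : EuclideanSpace ℝ (Fin d)) :
    jmass d m γ x =
      if m ^ 2 < minkForm d x ∧ 0 < x 0 then (minkForm d x - m ^ 2) ^ (-γ) else 0 := by
  have hiff : Real.sqrt ((∑ i ∈ Finset.univ.erase 0, x i ^ 2) + m ^ 2) < x 0 ↔
      m ^ 2 < minkForm d x ∧ 0 < x 0 := by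
    rw [minkForm, lt_sub_iff_add_lt']
    exact ⟨fun h => have h0 := (Real.sqrt_nonneg _).trans_lt h; ⟨(Real.sqrt_lt' h0).mp h, h0⟩,
      fun h => (Real.sqrt_lt' h.2).mpr h.1⟩
  simp only [jmass, hiff, minkForm, sub_sub]

lemma jmass_matAct_transpose (d : ℕ) [NeZero d] (m γ : ℝ) (Λ : Matrix (Fin d) (Fin d) ℝ)
    (hΛ : Λ.transpose * minkMatrix d * Λ = minkMatrix d) (hor : 0 < Λ 0 0)
    (x : EuclideanSpace ℝ (Fin d)) :
    jmass d m γ (matAct d Λ.transpose x) = jmass d m γ x := by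
  rw [jmass_eq, jmass_eq, minkForm_matAct d Λ.transpose
    (by simpa using lorentz_transpose d Λ hΛ)]
  congr 1
  exact propext <| and_congr_right fun h =>
    matAct_transpose_zero_pos_iff d Λ hΛ hor x ((sq_nonneg m).trans_lt h)

theorem stmt_4 (d : ℕ) [NeZero d] (hd : 2 ≤ d) (m γ : ℝ) (hm : 0 < m)
    (hγ : γ ∈ Set.Ioo (0 : ℝ) (1 / 2))
    (f : SchwartzMap (EuclideanSpace ℝ (Fin d)) ℂ)
    (Λ : Matrix (Fin d) (Fin d) ℝ)
    (hΛ : Λ.transpose * minkMatrix d * Λ = minkMatrix d)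
    (hdet : Λ.det = 1) (hor : 0 < Λ 0 0) :
    ∀ x : EuclideanSpace ℝ (Fin d),
      Jop d m γ (fun y => f (matAct d Λ y)) x = Jop d m γ (⇑f) (matAct d Λ x) := by
  intro x
  rw [Jop, Jop, Real.fourierInv_eq, Real.fourierInv_eq,
    ← integral_comp_matAct d Λ.transpose (by rwa [Matrix.det_transpose])]
  simp only [jmass_matAct_transpose d m γ Λ hΛ hor, fourier_comp_matAct d Λ hdet,
    inner_matAct_left, Matrix.transpose_transpose]
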